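/- arXiv:2102.10458 — 3 statements merged into one kernel-verified Lean document; each statement's English description precedes it below -/
import Mathlib

section
/- Let m ≥ n ≥ 1 and let A, Â ∈ ℂ^{m×n} be column-orthonormal matrices. Then (1/2) · Σ_{S ⊆ [m], |S| = n} | |det(Â_S)|² − |det(A_S)|² | ≤ n · ‖Â − A‖₂. (This is the paper's Lemma: the total variation distance between the non-interacting fermion distributions induced by Â and A is at most n times the spectral distance between Â and A.) -/
open Matrix
open scoped Matrix.Norms.L2Operator

/-- The `n × n` submatrix of an `m × n` matrix consisting of the rows indexed by
a subset `S ⊆ [m]` with `|S| = n`. -/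
noncomputable def rowSubmatrix {m n : ℕ} (A : Matrix (Fin m) (Fin n) ℂ)
    (S : Finset (Fin m)) (hS : S.card = n) : Matrix (Fin n) (Fin n) ℂ :=
  A.submatrix (fun i => ((S.orderIsoOfFin hS i : {x // x ∈ S}) : Fin m)) id

open Equiv in
/-- The sum of squared moduli of the minors over all row selections (repetitions allowed) is
`n!` times the Gram determinant. -/
theorem Matrix.sum_norm_sq_det_submatrix {m n : Type*} [Fintype m] [Fintype n] [DecidableEq n]
    (M : Matrix m n ℂ) :
    ∑ f : n → m, ((‖(M.submatrix f id).det‖ ^ 2 : ℝ) : ℂ)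
      = (Fintype.card n).factorial * (Mᴴ * M).det := by
  have gram : ∑ f : n → m, (∏ j, star (M (f j) j)) * (M.submatrix f id).det = (Mᴴ * M).det := by
    simp_rw [← det_transpose (Mᴴ * M), ← det_transpose (M.submatrix _ id), det_apply',
      Finset.mul_sum]
    rw [Finset.sum_comm]
    refine Finset.sum_congr rfl fun σ _ => ?_
    simp only [mul_apply, conjTranspose_apply, transpose_apply, submatrix_apply, id]
    rw [Finset.prod_univ_sum, Finset.mul_sum, Fintype.piFinset_univ]
    refine Finset.sum_congr rfl fun f _ => ?_
    rw [mul_left_comm, Finset.prod_mul_distrib]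
  have perm (σ : Perm n) :
      ∑ f : n → m, (Perm.sign σ : ℂ) * (∏ j, star (M (f (σ j)) j)) * (M.submatrix f id).det
        = (Mᴴ * M).det := by
    rw [← gram, ← (σ.arrowCongr (Equiv.refl m)).sum_comp]
    refine Finset.sum_congr rfl fun f _ => ?_
    have hdet : (M.submatrix (σ.arrowCongr (Equiv.refl m) f) id).det
        = Perm.sign σ * (M.submatrix f id).det := by
      rw [← Perm.sign_inv, ← det_permute]
      rfl
    have hsign : (Perm.sign σ : ℂ) * Perm.sign σ = 1 := by
      rcases Int.units_eq_one_or (Perm.sign σ) with h | h <;> simp [h]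
    rw [hdet, mul_mul_mul_comm, hsign, one_mul]
    simp
  calc
    _ = ∑ f : n → m, ∑ σ : Perm n,
        (Perm.sign σ : ℂ) * (∏ j, star (M (f (σ j)) j)) * (M.submatrix f id).det := by
      refine Finset.sum_congr rfl fun f _ => ?_
      rw [← Finset.sum_mul, Complex.ofReal_pow, ← Complex.conj_mul']
      congr 1
      simp [det_apply', map_sum, map_mul, map_prod]
    _ = _ := by
      rw [Finset.sum_comm, Finset.sum_congr rfl fun σ _ => perm σ]
      simp [Fintype.card_perm]

/-- Cauchy–Binet, as an upper bound on the sum over maximal minors. -/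
theorem sum_norm_sq_det_rowSubmatrix_le {m n : ℕ} (M : Matrix (Fin m) (Fin n) ℂ) :
    ∑ S : {S : Finset (Fin m) // S.card = n}, ‖(rowSubmatrix M S.1 S.2).det‖ ^ 2
      ≤ (Mᴴ * M).det.re := by
  let e (p : {S : Finset (Fin m) // S.card = n} × Equiv.Perm (Fin n)) : Fin n → Fin m :=
    fun i => (p.1.1.orderIsoOfFin p.1.2 (p.2 i) : Fin m)
  have he : Function.Injective e := by
    rintro ⟨⟨S, hS⟩, σ⟩ ⟨⟨T, hT⟩, τ⟩ h
    have range_e (p) : Set.range (e p) = p.1.1 := by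
      have : e p = (Subtype.val ∘ p.1.1.orderIsoOfFin p.1.2) ∘ p.2 := rfl
      rw [this, p.2.surjective.range_comp, (OrderIso.surjective _).range_comp]
      simp
    have hST : S = T := by
      have := (range_e _).symm.trans ((congrArg Set.range h).trans (range_e _))
      exact_mod_cast this
    subst hST
    congr 1
    ext i
    exact congrArg Fin.val (by simpa [e] using congrFun h i)
  have key : (n.factorial : ℝ) *
      ∑ S : {S : Finset (Fin m) // S.card = n}, ‖(rowSubmatrix M S.1 S.2).det‖ ^ 2
        ≤ n.factorial * (Mᴴ * M).det.re := by
    have h := congrArg Complex.re M.sum_norm_sq_det_submatrix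
    rw [← Complex.ofReal_sum, Complex.ofReal_re, Fintype.card_fin, ← nsmul_eq_mul,
      Complex.re_nsmul, nsmul_eq_mul] at h
    rw [← h]
    calc
      _ = ∑ p, ‖(M.submatrix (e p) id).det‖ ^ 2 := by
        rw [Fintype.sum_prod_type, Finset.mul_sum]
        refine Finset.sum_congr rfl fun S _ => ?_
        have (σ : Equiv.Perm (Fin n)) : ‖(M.submatrix (e (S, σ)) id).det‖
            = ‖(rowSubmatrix M S.1 S.2).det‖ := by
          have : M.submatrix (e (S, σ)) id = (rowSubmatrix M S.1 S.2).submatrix σ id := rfl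
          rw [this, det_permute, norm_mul]
          rcases Int.units_eq_one_or (Equiv.Perm.sign σ) with h | h <;> simp [h]
        simp [this, Fintype.card_perm]
      _ = ∑ f ∈ Finset.univ.map ⟨e, he⟩, ‖(M.submatrix f id).det‖ ^ 2 := by
        rw [Finset.sum_map]
        rfl
      _ ≤ _ := Finset.sum_le_sum_of_subset_of_nonneg (Finset.subset_univ _)
        fun _ _ _ => by positivity
  exact le_of_mul_le_mul_left key (by positivity)

open scoped ComplexOrder in
/-- A Gram matrix with diagonal entries at most one has determinant at most one. -/
theorem Matrix.re_det_conjTranspose_mul_self_le_one {m n : Type*} [Fintype m] [Fintype n]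
    [DecidableEq n] (M : Matrix m n ℂ) (h : ∀ j, ∑ i, ‖M i j‖ ^ 2 ≤ 1) :
    (Mᴴ * M).det.re ≤ 1 := by
  have hM := posSemidef_conjTranspose_mul_self M
  have trace_le : ∑ j, hM.1.eigenvalues j ≤ Fintype.card n := by
    have := congrArg Complex.re hM.1.trace_eq_sum_eigenvalues
    have ht : (Mᴴ * M).trace.re = ∑ j, ∑ i, ‖M i j‖ ^ 2 := by
      simp [trace, mul_apply, Complex.conj_mul', ← Complex.ofReal_pow]
    rw [ht] at this
    calc
      _ = ∑ j, ∑ i, ‖M i j‖ ^ 2 := by rw [this]; simp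
      _ ≤ ∑ j : n, 1 := Finset.sum_le_sum fun j _ => h j
      _ = _ := by simp
  rw [hM.1.det_eq_prod_eigenvalues]
  calc
    _ = ∏ j, hM.1.eigenvalues j := by
      rw [← Complex.ofReal_re (∏ j, hM.1.eigenvalues j), Complex.ofReal_prod]; rfl
    _ ≤ ∏ j, Real.exp (hM.1.eigenvalues j - 1) :=
      Finset.prod_le_prod (fun j _ => hM.eigenvalues_nonneg j) fun j _ => by
        simpa using Real.add_one_le_exp (hM.1.eigenvalues j - 1)
    _ = Real.exp (∑ j, hM.1.eigenvalues j - Fintype.card n) := by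
      rw [← Real.exp_sum, Finset.sum_sub_distrib]; simp
    _ ≤ 1 := Real.exp_le_one_iff.mpr (by linarith)

/-- The squared length of a column is bounded by the squared spectral norm. -/
theorem Matrix.sum_norm_sq_col_le {m n : Type*} [Fintype m] [Fintype n] [DecidableEq n]
    (M : Matrix m n ℂ) (j : n) : ∑ i, ‖M i j‖ ^ 2 ≤ ‖M‖ ^ 2 := by
  have h := M.l2_opNorm_mulVec (EuclideanSpace.single j 1)
  have hsq := pow_le_pow_left₀ (norm_nonneg _) h 2
  rw [EuclideanSpace.norm_sq_eq] at hsq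
  simpa using hsq

/-- The vector of maximal minors. -/
noncomputable def maximalMinors {m n : ℕ} (M : Matrix (Fin m) (Fin n) ℂ) :
    EuclideanSpace ℂ {S : Finset (Fin m) // S.card = n} :=
  WithLp.toLp 2 fun S => (rowSubmatrix M S.1 S.2).det

theorem norm_maximalMinors_le_one {m n : ℕ} (M : Matrix (Fin m) (Fin n) ℂ)
    (h : ∀ j, ∑ i, ‖M i j‖ ^ 2 ≤ 1) : ‖maximalMinors M‖ ≤ 1 := by
  rw [← sq_le_one_iff₀ (norm_nonneg _), EuclideanSpace.norm_sq_eq]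
  exact (sum_norm_sq_det_rowSubmatrix_le M).trans (M.re_det_conjTranspose_mul_self_le_one h)

theorem rowSubmatrix_updateCol {m n : ℕ} (M : Matrix (Fin m) (Fin n) ℂ) (k : Fin n)
    (v : Fin m → ℂ) (S : Finset (Fin m)) (hS : S.card = n) :
    rowSubmatrix (M.updateCol k v) S hS
      = (rowSubmatrix M S hS).updateCol k fun i => v (S.orderIsoOfFin hS i) := by
  ext i j
  simp [rowSubmatrix, updateCol_apply]

theorem maximalMinors_updateCol_add {m n : ℕ} (M : Matrix (Fin m) (Fin n) ℂ) (k : Fin n)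
    (u v : Fin m → ℂ) :
    maximalMinors (M.updateCol k (u + v))
      = maximalMinors (M.updateCol k u) + maximalMinors (M.updateCol k v) := by
  ext S
  simp only [maximalMinors, rowSubmatrix_updateCol, PiLp.add_apply]
  exact det_updateCol_add _ _ _ _

theorem maximalMinors_updateCol_smul {m n : ℕ} (M : Matrix (Fin m) (Fin n) ℂ) (k : Fin n)
    (c : ℂ) (v : Fin m → ℂ) :
    maximalMinors (M.updateCol k (c • v)) = c • maximalMinors (M.updateCol k v) := by
  ext S
  simp only [maximalMinors, rowSubmatrix_updateCol, PiLp.smul_apply]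
  exact det_updateCol_smul _ _ _ _

theorem norm_maximalMinors_updateCol_le {m n : ℕ} (M : Matrix (Fin m) (Fin n) ℂ)
    (h : ∀ j, ∑ i, ‖M i j‖ ^ 2 ≤ 1) (k : Fin n) (v : Fin m → ℂ) {r : ℝ} (hr : 0 < r)
    (hv : ∑ i, ‖v i‖ ^ 2 ≤ r ^ 2) : ‖maximalMinors (M.updateCol k v)‖ ≤ r := by
  have hscale : v = (r : ℂ) • ((r : ℂ)⁻¹ • v) := by
    rw [smul_inv_smul₀ (by exact_mod_cast hr.ne')]
  rw [hscale, maximalMinors_updateCol_smul, norm_smul, Complex.norm_of_nonneg hr.le]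
  refine mul_le_of_le_one_right hr.le (norm_maximalMinors_le_one _ fun j => ?_)
  by_cases hj : j = k
  · subst hj
    simp only [updateCol_self, Pi.smul_apply, smul_eq_mul, norm_mul, mul_pow, ← Finset.mul_sum]
    rw [norm_inv, Complex.norm_of_nonneg hr.le, inv_pow, inv_mul_le_iff₀ (by positivity)]
    simpa using hv
  · simpa [updateCol_ne hj] using h j

/-- On matrices with columns of length at most one, the vector of maximal minors is
`n`-Lipschitz for the spectral norm. -/
theorem norm_maximalMinors_sub_le {m n : ℕ} (A B : Matrix (Fin m) (Fin n) ℂ)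
    (hA : ∀ j, ∑ i, ‖A i j‖ ^ 2 ≤ 1) (hB : ∀ j, ∑ i, ‖B i j‖ ^ 2 ≤ 1) :
    ‖maximalMinors B - maximalMinors A‖ ≤ n * ‖B - A‖ := by
  rcases (norm_nonneg (B - A)).eq_or_lt with h0 | hpos
  · rw [eq_comm, norm_eq_zero, sub_eq_zero] at h0
    simp [h0]
  let H (k : ℕ) : Matrix (Fin m) (Fin n) ℂ := of fun i j => if (j : ℕ) < k then B i j else A i j
  have hH (k : ℕ) (j) : ∑ i, ‖H k i j‖ ^ 2 ≤ 1 := by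
    by_cases hj : (j : ℕ) < k <;> simp [H, hj, hA, hB]
  have step (k : ℕ) (hk : k < n) : dist (maximalMinors (H k)) (maximalMinors (H (k + 1)))
      ≤ ‖B - A‖ := by
    have h1 : H k = (H k).updateCol ⟨k, hk⟩ fun i => A i ⟨k, hk⟩ := by
      ext i j
      by_cases hj : j = ⟨k, hk⟩ <;> simp [H, hj]
    have h2 : H (k + 1) = (H k).updateCol ⟨k, hk⟩
        ((fun i => (B - A) i ⟨k, hk⟩) + fun i => A i ⟨k, hk⟩) := by
      ext i j
      by_cases hj : j = ⟨k, hk⟩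
      · simp [H, hj]
      · have : (j : ℕ) ≠ k := fun h => hj (Fin.ext h)
        have : (j : ℕ) < k + 1 ↔ (j : ℕ) < k := by omega
        simp [H, hj, this]
    rw [dist_comm, dist_eq_norm, h2, maximalMinors_updateCol_add, ← h1, add_sub_cancel_right]
    exact norm_maximalMinors_updateCol_le _ (hH k) _ _ hpos ((B - A).sum_norm_sq_col_le _)
  have h0 : H 0 = A := by ext i j; simp [H]
  have hn : H n = B := by ext i j; simp [H]
  calc
    _ = dist (maximalMinors (H 0)) (maximalMinors (H n)) := by
      rw [dist_comm, dist_eq_norm, h0, hn]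
    _ ≤ ∑ k ∈ Finset.range n, dist (maximalMinors (H k)) (maximalMinors (H (k + 1))) :=
      dist_le_range_sum_dist (fun k => maximalMinors (H k)) n
    _ ≤ ∑ k ∈ Finset.range n, ‖B - A‖ :=
      Finset.sum_le_sum fun k hk => step k (Finset.mem_range.mp hk)
    _ = _ := by simp

/-- The `ℓ¹` distance of squared moduli of two vectors in the unit ball is at most twice their
Euclidean distance. -/
theorem EuclideanSpace.sum_abs_norm_sq_sub_le {ι : Type*} [Fintype ι] (x y : EuclideanSpace ℂ ι)
    (hx : ‖x‖ ≤ 1) (hy : ‖y‖ ≤ 1) : ∑ i, |‖x i‖ ^ 2 - ‖y i‖ ^ 2| ≤ 2 * ‖x - y‖ := by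
  have cauchy (z : EuclideanSpace ℂ ι) (hz : ‖z‖ ≤ 1) :
      ∑ i, ‖(x - y) i‖ * ‖z i‖ ≤ ‖x - y‖ := by
    have h := Real.sum_mul_le_sqrt_mul_sqrt Finset.univ (fun i => ‖(x - y) i‖) fun i => ‖z i‖
    rw [← EuclideanSpace.norm_eq, ← EuclideanSpace.norm_eq] at h
    exact h.trans (mul_le_of_le_one_right (norm_nonneg _) hz)
  calc
    _ ≤ ∑ i, (‖(x - y) i‖ * ‖x i‖ + ‖(x - y) i‖ * ‖y i‖) := by
      refine Finset.sum_le_sum fun i _ => ?_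
      rw [sq_sub_sq, abs_mul, abs_of_nonneg (by positivity), ← mul_add, mul_comm]
      exact mul_le_mul_of_nonneg_right (abs_norm_sub_norm_le _ _) (by positivity)
    _ ≤ 2 * ‖x - y‖ := by
      rw [Finset.sum_add_distrib]
      linarith [cauchy x hx, cauchy y hy]

theorem Matrix.sum_norm_sq_col_of_conjTranspose_mul_self {m n : Type*} [Fintype m]
    [DecidableEq n] (M : Matrix m n ℂ) (hM : Mᴴ * M = 1) (j : n) :
    ∑ i, ‖M i j‖ ^ 2 = 1 := by
  have h := congrArg Complex.re (congrFun (congrFun hM j) j)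
  simpa [mul_apply, Complex.conj_mul', ← Complex.ofReal_pow] using h

theorem stmt0 (m n : ℕ) (hn : 1 ≤ n) (hmn : n ≤ m)
    (A Ahat : Matrix (Fin m) (Fin n) ℂ)
    (hA : Aᴴ * A = 1) (hAhat : Ahatᴴ * Ahat = 1) :
    (1 / 2 : ℝ) * ∑ S : {S : Finset (Fin m) // S.card = n},
        |‖(rowSubmatrix Ahat S.1 S.2).det‖ ^ 2
          - ‖(rowSubmatrix A S.1 S.2).det‖ ^ 2|
      ≤ n * ‖Ahat - A‖ := by
  have cA j := (A.sum_norm_sq_col_of_conjTranspose_mul_self hA j).le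
  have cAhat j := (Ahat.sum_norm_sq_col_of_conjTranspose_mul_self hAhat j).le
  have h := EuclideanSpace.sum_abs_norm_sq_sub_le _ _
    (norm_maximalMinors_le_one Ahat cAhat) (norm_maximalMinors_le_one A cA)
  have hsub := norm_maximalMinors_sub_le A Ahat cA cAhat
  simp only [maximalMinors] at h hsub
  linarith
end

section
/- Let m ≥ n ≥ 1 and let A, Â ∈ ℂ^{m×n} be column-orthonormal matrices, and set K = AAᴴ and K̂ = ÂÂᴴ. Then there exists a unitary matrix R ∈ ℂ^{n×n} such that (1/2) · ‖ÂR − A‖₂ ≤ ‖K̂ − K‖₂ ≤ 2 · ‖ÂR − A‖₂. -/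
open Matrix
open scoped Matrix.Norms.L2Operator

/-- A matrix with orthonormal columns has spectral norm at most one. -/
lemma l2_opNorm_le_one_of_conjTranspose_mul_self_eq_one {m n : ℕ}
    {B : Matrix (Fin m) (Fin n) ℂ} (hB : Bᴴ * B = 1) : ‖B‖ ≤ 1 := by
  have h := l2_opNorm_conjTranspose_mul_self B
  rw [hB] at h
  have h1 := l2_opNorm_conjTranspose_mul_self (1 : Matrix (Fin n) (Fin n) ℂ)
  rw [conjTranspose_one, Matrix.one_mul] at h1
  have h2 : ‖(1 : Matrix (Fin n) (Fin n) ℂ)‖ ≤ 1 := by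
    by_contra! hlt
    nlinarith
  nlinarith [norm_nonneg B]

/-- Unitary polar factor of a matrix whose Gram matrix is close to the identity. -/
lemma exists_unitary_polar_factor {n : ℕ} (M : Matrix (Fin n) (Fin n) ℂ)
    (hM : ‖1 - Mᴴ * M‖ < 1) :
    ∃ R : Matrix (Fin n) (Fin n) ℂ, Rᴴ * R = 1 ∧ (Rᴴ * M)ᴴ = Rᴴ * M ∧
      ‖1 - Rᴴ * M‖ ≤ ‖1 - Mᴴ * M‖ := by
  set a := Mᴴ * M with ha
  have hsa : IsSelfAdjoint a := IsSelfAdjoint.star_mul_self M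
  have hcont (f : ℝ → ℝ) : ContinuousOn f (spectrum ℝ a) :=
    (Matrix.finite_real_spectrum (A := a)).continuousOn f
  have hid : a = cfc (fun x : ℝ => x) a := (cfc_id' ℝ a).symm
  have hone_sub (f : ℝ → ℝ) : 1 - cfc f a = cfc (fun x => 1 - f x) a := by
    rw [cfc_sub (fun _ => (1 : ℝ)) f a (hcont _) (hcont _), cfc_const_one ℝ a]
  have hspec : ∀ x ∈ spectrum ℝ a, |1 - x| ≤ ‖1 - a‖ := by
    intro x hx
    have := norm_apply_le_norm_cfc (fun x : ℝ => 1 - x) a hx (hcont _)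
    rwa [← hone_sub, ← hid] at this
  have hpos : ∀ x ∈ spectrum ℝ a, 0 < x := fun x hx => by
    linarith [(abs_lt.1 ((hspec x hx).trans_lt hM)).2]
  set S := cfc (fun x : ℝ => (√x)⁻¹) a with hS
  have hSs : Sᴴ = S := (cfc_predicate (fun x : ℝ => (√x)⁻¹) a : IsSelfAdjoint _)
  have hSa : S * a = cfc (fun x : ℝ => √x) a := by
    conv_lhs => rw [hS]; arg 2; rw [hid]
    rw [← cfc_mul _ _ a (hcont _) (hcont _)]
    refine cfc_congr fun x hx => ?_
    have h0 := hpos x hx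
    have h1 := Real.mul_self_sqrt h0.le
    have h2 := (Real.sqrt_pos.2 h0).ne'
    field_simp
    nlinarith
  have hRM : (M * S)ᴴ * M = cfc (fun x : ℝ => √x) a := by
    rw [conjTranspose_mul, hSs, Matrix.mul_assoc, ← ha, hSa]
  refine ⟨M * S, ?_, ?_, ?_⟩
  · rw [← Matrix.mul_assoc, hRM, hS, ← cfc_mul _ _ a (hcont _) (hcont _), ← cfc_const_one ℝ a]
    exact cfc_congr fun x hx => mul_inv_cancel₀ (Real.sqrt_pos.2 (hpos x hx)).ne'
  · rw [hRM]
    exact (cfc_predicate (fun x : ℝ => √x) a : IsSelfAdjoint _)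
  · rw [hRM, hone_sub]
    refine norm_cfc_le (norm_nonneg _) fun x hx => le_trans ?_ (hspec x hx)
    have h1 := Real.mul_self_sqrt (hpos x hx).le
    have h2 := Real.sqrt_nonneg x
    have h3 : 1 - x = (1 - √x) * (1 + √x) := by linarith
    rw [Real.norm_eq_abs, h3, abs_mul, abs_of_nonneg (by linarith : 0 ≤ 1 + √x)]
    nlinarith [abs_nonneg (1 - √x)]

/-- The spectral distance of two projections is at most twice the distance of their factors. -/
lemma norm_mul_conjTranspose_sub_le {m n : ℕ} {A B : Matrix (Fin m) (Fin n) ℂ}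
    (hA : Aᴴ * A = 1) (hB : Bᴴ * B = 1) : ‖B * Bᴴ - A * Aᴴ‖ ≤ 2 * ‖B - A‖ := by
  have hA1 := l2_opNorm_le_one_of_conjTranspose_mul_self_eq_one hA
  have hB1 := l2_opNorm_le_one_of_conjTranspose_mul_self_eq_one hB
  have h : B * Bᴴ - A * Aᴴ = (B - A) * Bᴴ + A * (B - A)ᴴ := by
    rw [conjTranspose_sub, Matrix.sub_mul, Matrix.mul_sub]; abel
  have h1 := l2_opNorm_mul (B - A) Bᴴ
  have h2 := l2_opNorm_mul A (B - A)ᴴ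
  rw [l2_opNorm_conjTranspose] at h1 h2
  rw [h]
  refine (norm_add_le _ _).trans ?_
  nlinarith [norm_nonneg (B - A)]

/-- The Gram defect of `Âᴴ A` is bounded by the squared spectral distance of the projections. -/
lemma norm_one_sub_gram_le {m n : ℕ} {A Ahat : Matrix (Fin m) (Fin n) ℂ}
    (hA : Aᴴ * A = 1) (hAhat : Ahatᴴ * Ahat = 1) :
    ‖1 - (Ahatᴴ * A)ᴴ * (Ahatᴴ * A)‖ ≤ ‖Ahat * Ahatᴴ - A * Aᴴ‖ ^ 2 := by
  have hA1 := l2_opNorm_le_one_of_conjTranspose_mul_self_eq_one hA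
  set D := Ahat * Ahatᴴ - A * Aᴴ with hD
  have hDA : D * A = Ahat * (Ahatᴴ * A) - A := by
    rw [hD, Matrix.sub_mul, Matrix.mul_assoc, Matrix.mul_assoc, hA, Matrix.mul_one]
  have h : 1 - (Ahatᴴ * A)ᴴ * (Ahatᴴ * A) = (D * A)ᴴ * (D * A) := by
    have h1 : Ahatᴴ * (Ahat * (Ahatᴴ * A)) = Ahatᴴ * A := by
      rw [← Matrix.mul_assoc, hAhat, Matrix.one_mul]
    rw [hDA]
    simp only [conjTranspose_sub, conjTranspose_mul, conjTranspose_conjTranspose, Matrix.sub_mul,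
      Matrix.mul_sub, Matrix.mul_assoc, hA, h1]
    abel
  rw [h, l2_opNorm_conjTranspose_mul_self, ← pow_two]
  refine pow_le_pow_left₀ (norm_nonneg _) ((l2_opNorm_mul D A).trans ?_) 2
  exact mul_le_of_le_one_right (norm_nonneg _) hA1

theorem stmt4 (m n : ℕ) (hn : 1 ≤ n) (hmn : n ≤ m)
    (A Ahat : Matrix (Fin m) (Fin n) ℂ)
    (hA : Aᴴ * A = 1) (hAhat : Ahatᴴ * Ahat = 1) :
    ∃ R : Matrix (Fin n) (Fin n) ℂ, Rᴴ * R = 1 ∧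
      (1 / 2 : ℝ) * ‖Ahat * R - A‖ ≤ ‖Ahat * Ahatᴴ - A * Aᴴ‖ ∧
      ‖Ahat * Ahatᴴ - A * Aᴴ‖ ≤ 2 * ‖Ahat * R - A‖ := by
  have hdefect := norm_one_sub_gram_le hA hAhat
  rcases le_or_gt 1 ‖Ahat * Ahatᴴ - A * Aᴴ‖ with hd | hd
  · refine ⟨1, by simp, ?_, ?_⟩
    · rw [Matrix.mul_one]
      linarith [norm_sub_le Ahat A, l2_opNorm_le_one_of_conjTranspose_mul_self_eq_one hA,
        l2_opNorm_le_one_of_conjTranspose_mul_self_eq_one hAhat]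
    · rw [Matrix.mul_one]
      exact norm_mul_conjTranspose_sub_le hA hAhat
  · obtain ⟨R, hR, hsymm, hle⟩ := exists_unitary_polar_factor (Ahatᴴ * A)
      (hdefect.trans_lt (by nlinarith [norm_nonneg (Ahat * Ahatᴴ - A * Aᴴ)]))
    have hB : (Ahat * R)ᴴ * (Ahat * R) = 1 := by
      rw [conjTranspose_mul, Matrix.mul_assoc, ← Matrix.mul_assoc Ahatᴴ, hAhat, Matrix.one_mul, hR]
    refine ⟨R, hR, ?_, ?_⟩
    · have hBA : (Ahat * R)ᴴ * A = Rᴴ * (Ahatᴴ * A) := by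
        rw [conjTranspose_mul, Matrix.mul_assoc]
      have hAB : Aᴴ * (Ahat * R) = Rᴴ * (Ahatᴴ * A) := by
        rw [← hsymm, ← hBA, conjTranspose_mul, conjTranspose_conjTranspose]
      have hgram : (Ahat * R - A)ᴴ * (Ahat * R - A) =
          (1 - Rᴴ * (Ahatᴴ * A)) + (1 - Rᴴ * (Ahatᴴ * A)) := by
        rw [conjTranspose_sub, Matrix.sub_mul, Matrix.mul_sub, Matrix.mul_sub, hB, hBA, hAB, hA]
        abel
      have hsq := l2_opNorm_conjTranspose_mul_self (Ahat * R - A)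
      rw [hgram] at hsq
      have htri := norm_add_le (1 - Rᴴ * (Ahatᴴ * A)) (1 - Rᴴ * (Ahatᴴ * A))
      have hnonneg := norm_nonneg (Ahat * Ahatᴴ - A * Aᴴ)
      have := abs_le_of_sq_le_sq (a := ‖Ahat * R - A‖) (b := 2 * ‖Ahat * Ahatᴴ - A * Aᴴ‖)
        (by nlinarith) (by positivity)
      linarith [le_abs_self ‖Ahat * R - A‖]
    · have h := norm_mul_conjTranspose_sub_le hA hB
      have hRR : R * Rᴴ = 1 := mul_eq_one_comm.1 hR
      rwa [conjTranspose_mul, Matrix.mul_assoc, ← Matrix.mul_assoc R, hRR, Matrix.one_mul] at h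
end

section
/- Let m ≥ n ≥ 1 and let A, Â ∈ ℂ^{m×n} be column-orthonormal matrices. Then the total variation distance between the induced non-interacting fermion distributions satisfies (1/2) · Σ_{S ⊆ [m], |S| = n} | |det(Â_S)|² − |det(A_S)|² | ≤ 2n · ‖ÂÂᴴ − AAᴴ‖₂. -/
open Matrix
open scoped Matrix.Norms.L2Operator

open scoped ComplexOrder

/-- Expansion of the determinant of a product of rectangular matrices over all row selections. -/
theorem det_mul_eq_sum_prod_mul_det_submatrix {ι κ R : Type*} [Fintype ι] [DecidableEq ι]
    [Fintype κ] [CommRing R] (B : Matrix ι κ R) (A : Matrix κ ι R) :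
    (B * A).det = ∑ f : ι → κ, (∏ i, B i (f i)) * (A.submatrix f id).det := by
  classical
  have hrow : B * A = fun i => ∑ k, B i k • A k := by
    ext i j
    simp [Matrix.mul_apply, Finset.sum_apply]
  change Matrix.detRowAlternating.toMultilinearMap (B * A) = _
  rw [hrow, MultilinearMap.map_sum]
  refine Finset.sum_congr rfl fun f _ => ?_
  rw [MultilinearMap.map_smul_univ, smul_eq_mul]
  rfl

/-- **Cauchy–Binet formula**. -/
theorem det_mul_eq_sum_det_rowSubmatrix {m n : ℕ} (B A : Matrix (Fin m) (Fin n) ℂ) :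
    (Bᵀ * A).det = ∑ S : {S : Finset (Fin m) // S.card = n},
      (rowSubmatrix B S.1 S.2).det * (rowSubmatrix A S.1 S.2).det := by
  classical
  let e : {S : Finset (Fin m) // S.card = n} × Equiv.Perm (Fin n) → Fin n → Fin m :=
    fun p i => p.1.1.orderIsoOfFin p.1.2 (p.2 i)
  have himage : ∀ p, Finset.univ.image (e p) = p.1.1 := by
    intro p
    ext x
    simp only [Finset.mem_image, Finset.mem_univ, true_and]
    refine ⟨?_, fun hx => ⟨p.2.symm ((p.1.1.orderIsoOfFin p.1.2).symm ⟨x, hx⟩),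
      by simp [e, -Finset.coe_orderIsoOfFin_apply]⟩⟩
    rintro ⟨i, rfl⟩
    exact (p.1.1.orderIsoOfFin p.1.2 (p.2 i)).2
  have he : Function.Injective e := by
    rintro ⟨S, σ⟩ ⟨T, τ⟩ h
    have hST : S = T := Subtype.ext (by rw [← himage (S, σ), h, himage])
    subst hST
    congr 1
    refine Equiv.ext fun i => ?_
    have hi := congrFun h i
    simpa [e, -Finset.coe_orderIsoOfFin_apply] using hi
  have hrange : ∀ f : Fin n → Fin m, Function.Injective f → f ∈ Set.range e := by
    intro f hf
    have hcard : (Finset.univ.image f).card = n := by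
      simp [Finset.card_image_of_injective _ hf]
    let g : Fin n → Fin n := fun i =>
      ((Finset.univ.image f).orderIsoOfFin hcard).symm
        ⟨f i, Finset.mem_image_of_mem f (Finset.mem_univ i)⟩
    have hg : Function.Injective g := fun i j h => hf (by simpa [g] using h)
    refine ⟨(⟨Finset.univ.image f, hcard⟩,
      Equiv.ofBijective g (Finite.injective_iff_bijective.mp hg)), ?_⟩
    ext i
    simp [e, g, -Finset.coe_orderIsoOfFin_apply]
  rw [det_mul_eq_sum_prod_mul_det_submatrix, ← Fintype.sum_of_injective e he
    (fun p => (∏ i, Bᵀ i (e p i)) * (A.submatrix (e p) id).det) _ ?_ fun _ => rfl,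
    Fintype.sum_prod_type]
  · refine Finset.sum_congr rfl fun S _ => ?_
    rw [Matrix.det_apply', Finset.sum_mul]
    refine Finset.sum_congr rfl fun σ _ => ?_
    have hA : A.submatrix (e (S, σ)) id = (rowSubmatrix A S.1 S.2).submatrix σ id := rfl
    have hB : ∏ i, Bᵀ i (e (S, σ) i) = ∏ i, rowSubmatrix B S.1 S.2 (σ i) i := rfl
    rw [hA, hB, Matrix.det_permute]
    ring
  · intro f hf
    obtain ⟨i, j, hij, hne⟩ : ∃ i j, f i = f j ∧ i ≠ j := by
      by_contra! h
      exact hf (hrange f fun i j hij => h i j hij)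
    rw [Matrix.det_zero_of_row_eq hne (by ext k; simp [hij]), mul_zero]

/-- The `ℓ¹` distance between the squared moduli of two unit vectors is bounded through their
overlap. -/
theorem sq_sum_abs_norm_sq_sub_norm_sq_le {ι : Type*} [Fintype ι] (a b : ι → ℂ)
    (ha : ∑ i, ‖a i‖ ^ 2 = 1) (hb : ∑ i, ‖b i‖ ^ 2 = 1) :
    (∑ i, |‖a i‖ ^ 2 - ‖b i‖ ^ 2|) ^ 2 ≤ 4 * (1 - ‖∑ i, star (b i) * a i‖ ^ 2) := by
  set c := ∑ i, star (b i) * a i with hc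
  obtain ⟨u, hu, huc⟩ : ∃ u : ℂ, ‖u‖ = 1 ∧ u * c = ‖c‖ := by
    by_cases h : c = 0
    · exact ⟨1, by simp, by simp [h]⟩
    · have h' : (‖c‖ : ℂ) ≠ 0 := by simpa using h
      refine ⟨‖c‖ / c, by simp [h], by field_simp⟩
  have hre : ∑ i, (star (b i) * (u * a i)).re = ‖c‖ := by
    rw [← Complex.re_sum, ← Complex.ofReal_re ‖c‖, ← huc, hc, Finset.mul_sum]
    congr 1
    exact Finset.sum_congr rfl fun i _ => by ring
  have hnorm : ∀ i, ‖u * a i‖ = ‖a i‖ := fun i => by rw [norm_mul, hu, one_mul]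
  have hsub : ∑ i, ‖u * a i - b i‖ ^ 2 = 2 - 2 * ‖c‖ := by
    have h : ∀ i, ‖u * a i - b i‖ ^ 2
        = ‖a i‖ ^ 2 + ‖b i‖ ^ 2 - 2 * (star (b i) * (u * a i)).re := fun i => by
      rw [← hnorm i]
      simp only [Complex.sq_norm, Complex.normSq_apply, Complex.sub_re, Complex.sub_im,
        Complex.star_def, Complex.mul_re (starRingEnd ℂ (b i)), Complex.conj_re, Complex.conj_im]
      ring
    simp only [h, Finset.sum_sub_distrib, Finset.sum_add_distrib, ← Finset.mul_sum, ha, hb, hre]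
    ring
  have hadd : ∑ i, ‖u * a i + b i‖ ^ 2 = 2 + 2 * ‖c‖ := by
    have h : ∀ i, ‖u * a i + b i‖ ^ 2
        = ‖a i‖ ^ 2 + ‖b i‖ ^ 2 + 2 * (star (b i) * (u * a i)).re := fun i => by
      rw [← hnorm i]
      simp only [Complex.sq_norm, Complex.normSq_apply, Complex.add_re, Complex.add_im,
        Complex.star_def, Complex.mul_re (starRingEnd ℂ (b i)), Complex.conj_re, Complex.conj_im]
      ring
    simp only [h, Finset.sum_add_distrib, ← Finset.mul_sum, ha, hb, hre]
    ring
  have hle : ∀ i, |‖a i‖ ^ 2 - ‖b i‖ ^ 2| ≤ ‖u * a i - b i‖ * ‖u * a i + b i‖ := fun i => by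
    have h : ‖a i‖ ^ 2 - ‖b i‖ ^ 2 = ((u * a i - b i) * star (u * a i + b i)).re := by
      rw [← hnorm i]
      simp only [Complex.sq_norm, Complex.normSq_apply, Complex.star_def,
        Complex.mul_re (u * a i - b i), Complex.conj_re, Complex.conj_im, Complex.add_re,
        Complex.add_im, Complex.sub_re, Complex.sub_im]
      ring
    rw [h]
    refine (Complex.abs_re_le_norm _).trans_eq ?_
    rw [norm_mul, norm_star]
  calc (∑ i, |‖a i‖ ^ 2 - ‖b i‖ ^ 2|) ^ 2
      ≤ (∑ i, ‖u * a i - b i‖ * ‖u * a i + b i‖) ^ 2 := by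
        gcongr with i
        exact hle i
    _ ≤ (∑ i, ‖u * a i - b i‖ ^ 2) * ∑ i, ‖u * a i + b i‖ ^ 2 :=
        Finset.sum_mul_sq_le_sq_mul_sq _ _ _
    _ = 4 * (1 - ‖c‖ ^ 2) := by rw [hsub, hadd]; ring

/-- The inner product of the vectors of maximal minors of `B` and `A` is `det (Bᴴ * A)`. -/
theorem sum_star_det_mul_det_rowSubmatrix {m n : ℕ} (B A : Matrix (Fin m) (Fin n) ℂ) :
    ∑ S : {S : Finset (Fin m) // S.card = n},
      star (rowSubmatrix B S.1 S.2).det * (rowSubmatrix A S.1 S.2).det = (Bᴴ * A).det := by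
  have h := det_mul_eq_sum_det_rowSubmatrix (B.map star) A
  rw [show (B.map star)ᵀ = Bᴴ from rfl] at h
  rw [h]
  refine Finset.sum_congr rfl fun S _ => ?_
  rw [← Matrix.det_conjTranspose, ← Matrix.det_transpose]
  rfl

/-- The squared moduli of the maximal minors of a column-orthonormal matrix sum to one. -/
theorem sum_norm_sq_det_rowSubmatrix {m n : ℕ} (A : Matrix (Fin m) (Fin n) ℂ) (hA : Aᴴ * A = 1) :
    ∑ S : {S : Finset (Fin m) // S.card = n}, ‖(rowSubmatrix A S.1 S.2).det‖ ^ 2 = 1 := by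
  have h := sum_star_det_mul_det_rowSubmatrix A A
  rw [hA, Matrix.det_one] at h
  simp only [Complex.star_def, Complex.conj_mul'] at h
  exact_mod_cast h

/-- A positive semidefinite matrix within `δ` of the identity has determinant at least
`1 - n * δ`. -/
theorem one_sub_mul_le_norm_det_of_posSemidef {n : ℕ} {G : Matrix (Fin n) (Fin n) ℂ}
    (hG : G.PosSemidef) {δ : ℝ} (h : ‖1 - G‖ ≤ δ) : 1 - n * δ ≤ ‖G.det‖ := by
  have hδ : 0 ≤ δ := (norm_nonneg _).trans h
  rcases Nat.eq_zero_or_pos n with rfl | hn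
  · simp
  have : Nonempty (Fin n) := ⟨⟨0, hn⟩⟩
  rcases lt_or_ge 1 δ with h1 | h1
  · have : (1 : ℝ) ≤ n := by exact_mod_cast hn
    nlinarith [norm_nonneg G.det]
  have hev : ∀ i, 1 - δ ≤ hG.isHermitian.eigenvalues i := by
    intro i
    have hmem := hG.isHermitian.eigenvalues_mem_spectrum_real i
    have hmem' : 1 - hG.isHermitian.eigenvalues i ∈ spectrum ℝ (1 - G) := by
      rw [← map_one (algebraMap ℝ (Matrix (Fin n) (Fin n) ℂ)), ← spectrum.singleton_sub_eq]
      exact Set.sub_mem_sub rfl hmem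
    have := (spectrum.norm_le_norm_of_mem hmem').trans h
    rw [Real.norm_eq_abs] at this
    linarith [le_abs_self (1 - hG.isHermitian.eigenvalues i)]
  rw [hG.isHermitian.det_eq_prod_eigenvalues, norm_prod]
  calc 1 - n * δ = 1 + n * (-δ) := by ring
    _ ≤ (1 + -δ) ^ n := one_add_mul_le_pow (by linarith) n
    _ = ∏ _i : Fin n, (1 - δ) := by simp [sub_eq_add_neg]
    _ ≤ _ := Finset.prod_le_prod (fun i _ => by linarith) fun i _ =>
        (hev i).trans (by simpa using le_abs_self _)

/-- The overlap determinant of two column-orthonormal matrices is controlled by the distance of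
the projections onto their column spaces. -/
theorem one_sub_mul_sq_norm_le_sq_norm_det {m n : ℕ} (A B : Matrix (Fin m) (Fin n) ℂ)
    (hA : Aᴴ * A = 1) (hB : Bᴴ * B = 1) :
    1 - n * ‖B * Bᴴ - A * Aᴴ‖ ^ 2 ≤ ‖(Aᴴ * B).det‖ ^ 2 := by
  have hG : ((Aᴴ * B)ᴴ * (Aᴴ * B)).PosSemidef := Matrix.posSemidef_conjTranspose_mul_self _
  have hBnorm : ‖B‖ * ‖B‖ ≤ 1 := by
    rw [← Matrix.l2_opNorm_conjTranspose_mul_self, hB, ← Matrix.diagonal_one,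
      Matrix.l2_opNorm_diagonal]
    exact (pi_norm_le_iff_of_nonneg zero_le_one).mpr fun _ => by simp
  set D := B * Bᴴ - A * Aᴴ with hD
  have hDB : D * B = B - A * (Aᴴ * B) := by
    rw [hD, Matrix.sub_mul, Matrix.mul_assoc, hB, Matrix.mul_one, Matrix.mul_assoc]
  have hid : 1 - (Aᴴ * B)ᴴ * (Aᴴ * B) = (D * B)ᴴ * (D * B) := by
    have h : Aᴴ * (D * B) = 0 := by
      rw [hDB, Matrix.mul_sub, ← Matrix.mul_assoc Aᴴ A, hA, Matrix.one_mul, sub_self]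
    nth_rw 1 [hDB]
    rw [Matrix.conjTranspose_sub, Matrix.sub_mul, Matrix.conjTranspose_mul A, Matrix.mul_assoc _ Aᴴ,
      h, Matrix.mul_zero, sub_zero, hDB, Matrix.mul_sub, hB, Matrix.conjTranspose_mul,
      Matrix.conjTranspose_conjTranspose, Matrix.mul_assoc]
  have hnorm : ‖1 - (Aᴴ * B)ᴴ * (Aᴴ * B)‖ ≤ ‖D‖ ^ 2 := by
    rw [hid, Matrix.l2_opNorm_conjTranspose_mul_self]
    have h := Matrix.l2_opNorm_mul D B
    calc ‖D * B‖ * ‖D * B‖ ≤ (‖D‖ * ‖B‖) * (‖D‖ * ‖B‖) := by gcongr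
      _ = ‖D‖ ^ 2 * (‖B‖ * ‖B‖) := by ring
      _ ≤ ‖D‖ ^ 2 * 1 := by gcongr
      _ = ‖D‖ ^ 2 := mul_one _
  have h := one_sub_mul_le_norm_det_of_posSemidef hG hnorm
  rwa [Matrix.det_mul, Matrix.det_conjTranspose, norm_mul, norm_star, ← sq] at h

theorem stmt7 (m n : ℕ) (hn : 1 ≤ n) (hmn : n ≤ m)
    (A Ahat : Matrix (Fin m) (Fin n) ℂ)
    (hA : Aᴴ * A = 1) (hAhat : Ahatᴴ * Ahat = 1) :
    (1 / 2 : ℝ) * ∑ S : {S : Finset (Fin m) // S.card = n},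
        |‖(rowSubmatrix Ahat S.1 S.2).det‖ ^ 2
          - ‖(rowSubmatrix A S.1 S.2).det‖ ^ 2|
      ≤ 2 * n * ‖Ahat * Ahatᴴ - A * Aᴴ‖ := by
  have htv := sq_sum_abs_norm_sq_sub_norm_sq_le _ _
    (sum_norm_sq_det_rowSubmatrix Ahat hAhat) (sum_norm_sq_det_rowSubmatrix A hA)
  rw [sum_star_det_mul_det_rowSubmatrix] at htv
  have hdet := one_sub_mul_sq_norm_le_sq_norm_det A Ahat hA hAhat
  have hn' : (1 : ℝ) ≤ n := by exact_mod_cast hn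
  set ε := ‖Ahat * Ahatᴴ - A * Aᴴ‖
  have hε : 0 ≤ ε := norm_nonneg _
  have hsq : (n : ℝ) * ε ^ 2 ≤ n ^ 2 * ε ^ 2 := by
    gcongr
    nlinarith
  have hle := abs_le_of_sq_le_sq' (b := 4 * n * ε) (htv.trans (by nlinarith [sq_nonneg (n * ε)]))
    (by positivity)
  linarith [hle.2]
end
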